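/- Let x ∈ [m]^n contain a duplicate (ED(x) = 0), let h : [m] → [n] be uniformly random, and let K be k independent uniform starting indices with 2 ≤ k ≤ n/32. Then the probability that |f*_{x,h}(K)| ≤ 2√(kn) and f*_{x,h}(K) contains two indices i ≠ j with x_i = x_j is at least k/(18n). -/

import Mathlib

/-- The set `f*(K)` of points reachable from the starting points `K` by iterating `f`. -/
def reachSet {V κ : Type*} (f : V → V) (K : κ → V) : Set V :=
  {j | ∃ a : κ, ∃ s : ℕ, f^[s] (K a) = j}

section ReachSet

variable {V κ : Type*} {f g : V → V} {K : κ → V} {A : Set V} {p v : V}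

theorem start_mem_reachSet (f : V → V) (K : κ → V) (a : κ) : K a ∈ reachSet f K :=
  ⟨a, 0, rfl⟩

theorem apply_mem_reachSet (hv : v ∈ reachSet f K) : f v ∈ reachSet f K := by
  obtain ⟨a, s, rfl⟩ := hv
  exact ⟨a, s + 1, Function.iterate_succ_apply' f s _⟩

theorem reachSet_subset (hK : ∀ a, K a ∈ A) (hA : ∀ w ∈ A, f w ∈ A) : reachSet f K ⊆ A := by
  rintro _ ⟨a, s, rfl⟩
  induction s with
  | zero => exact hK a
  | succ s ih => rw [Function.iterate_succ_apply']; exact hA _ ih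

theorem reachSet_eq_of_eqOn (h : ∀ w ∈ reachSet f K, f w = g w) :
    reachSet f K = reachSet g K := by
  have hfg : reachSet g K ⊆ reachSet f K :=
    reachSet_subset (start_mem_reachSet f K) fun w hw => h w hw ▸ apply_mem_reachSet hw
  refine (reachSet_subset (start_mem_reachSet g K)
    (A := {w | w ∈ reachSet g K}) ?_).antisymm hfg
  intro w hw
  exact h w (hfg hw) ▸ apply_mem_reachSet hw

/-- If `f` sends all of `A` to `g p`, where `p` is reachable for `g`, and agrees with `g`
elsewhere, then `f` reaches no more than `g`. -/
theorem reachSet_subset_of_redirect (hfg : ∀ w ∉ A, f w = g w) (hA : ∀ w ∈ A, f w = g p)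
    (hp : p ∈ reachSet g K) : reachSet f K ⊆ reachSet g K := by
  refine reachSet_subset (start_mem_reachSet g K) fun w hw => ?_
  by_cases hwA : w ∈ A
  · rw [hA w hwA]; exact apply_mem_reachSet hp
  · rw [hfg w hwA]; exact apply_mem_reachSet hw

theorem image_reachSet (π : Equiv.Perm V) (f : V → V) (K : κ → V) :
    reachSet (π ∘ f ∘ π.symm) (π ∘ K) = π '' reachSet f K := by
  apply Set.Subset.antisymm
  · refine reachSet_subset (fun a => ⟨_, start_mem_reachSet f K a, rfl⟩) ?_
    rintro _ ⟨w, hw, rfl⟩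
    exact ⟨f w, apply_mem_reachSet hw, by simp⟩
  · rw [Set.image_subset_iff]
    refine reachSet_subset (fun a => start_mem_reachSet _ (π ∘ K) a) fun w hw => ?_
    simpa using apply_mem_reachSet hw

end ReachSet

section Splitting

variable {V κ α : Type*}

/-- The event that at most `B` indices are reached and that these contain either two distinct
indices with equal labels, or both `i` and `j`. -/
def GoodEvent (B : ℝ) (i j : V) (y : V → α) (ω : (α → V) × (κ → V)) : Prop :=
  ((reachSet (ω.1 ∘ y) ω.2).ncard : ℝ) ≤ B ∧
    ((∃ p q : V, p ≠ q ∧ y p = y q ∧ p ∈ reachSet (ω.1 ∘ y) ω.2 ∧ q ∈ reachSet (ω.1 ∘ y) ω.2) ∨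
      (i ∈ reachSet (ω.1 ∘ y) ω.2 ∧ j ∈ reachSet (ω.1 ∘ y) ω.2))

open Classical in
/-- The points reached when walks are stopped on entering the label class of `v`. -/
noncomputable def stoppedReach (y : V → α) (v : V) (h : α → V) (K : κ → V) : Set V :=
  reachSet (fun w => if y w = y v then w else h (y w)) K

theorem stoppedReach_subset (y : V → α) (v : V) (h : α → V) (K : κ → V) (f : V → V)
    (hf : ∀ w, y w ≠ y v → f w = h (y w)) : stoppedReach y v h K ⊆ reachSet f K := by
  refine reachSet_subset (start_mem_reachSet f K) fun w hw => ?_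
  split_ifs with hy
  · exact hw
  · rw [← hf w hy]; exact apply_mem_reachSet hw

theorem stoppedReach_congr (y : V → α) (v : V) (h h' : α → V) (K : κ → V)
    (hh : ∀ w, y w ≠ y v → h (y w) = h' (y w)) :
    stoppedReach y v h K = stoppedReach y v h' K := by
  unfold stoppedReach
  congr 1
  funext w
  split_ifs with hy
  · rfl
  · exact hh w hy

open Classical in
/-- Exchange the hash values of the label of `v` and of the fresh label `c` if `v` is reached
by the stopped walks. -/
noncomputable def exchange (y : V → α) (v : V) (c : α) (ω : (α → V) × (κ → V)) :
    (α → V) × (κ → V) :=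
  if v ∈ stoppedReach y v ω.1 ω.2 then (ω.1 ∘ Equiv.swap (y v) c, ω.2) else ω

theorem exchange_involutive (y : V → α) (v : V) (c : α) (hc : ∀ w, y w ≠ c) :
    Function.Involutive (exchange (κ := κ) y v c) := by
  classical
  rintro ⟨h, K⟩
  have hst : stoppedReach y v (h ∘ Equiv.swap (y v) c) K = stoppedReach y v h K :=
    stoppedReach_congr _ _ _ _ _ fun w hw => by
      simp [Equiv.swap_apply_of_ne_of_ne hw (hc w)]
  by_cases hv : v ∈ stoppedReach y v h K
  · have hv' : v ∈ stoppedReach y v (h ∘ Equiv.swap (y v) c) K := hst ▸ hv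
    simp only [exchange, hv, if_true, hv', Function.comp_assoc]
    congr 1
    funext a
    simp
  · simp [exchange, hv]

theorem GoodEvent.of_redirect {B : ℝ} {i j : V} {y y' : V → α} {h h' : α → V} {K : κ → V}
    [Finite V] {A : Set V} {p : V} (hpA : p ∉ A) (hyA : ∀ w ∈ A, y w = y p)
    (hfg : ∀ w ∉ A, (h ∘ y) w = (h' ∘ y') w) (hA : ∀ w ∈ A, (h ∘ y) w = (h' ∘ y') p)
    (hp : p ∈ reachSet (h ∘ y) K) (hp' : p ∈ reachSet (h' ∘ y') K)
    (hyy : ∀ a b, y' a = y' b → y a = y b)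
    (hgood : GoodEvent B i j y' (h', K)) : GoodEvent B i j y (h, K) := by
  obtain ⟨hcard, hor⟩ := hgood
  have hsub := reachSet_subset_of_redirect hfg hA hp'
  refine ⟨le_trans (by exact_mod_cast Set.ncard_le_ncard hsub (Set.toFinite _)) hcard, ?_⟩
  by_cases hhit : ∃ w ∈ A, w ∈ reachSet (h ∘ y) K
  · obtain ⟨w, hwA, hw⟩ := hhit
    exact Or.inl ⟨w, p, fun e => hpA (e ▸ hwA), hyA w hwA, hw, hp⟩
  · push Not at hhit
    have heq : reachSet (h ∘ y) K = reachSet (h' ∘ y') K :=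
      reachSet_eq_of_eqOn fun w hw => hfg w fun hwA => hhit w hwA hw
    simp only [heq]
    refine hor.imp_left ?_
    rintro ⟨a, b, hab, hyab, ha, hb⟩
    exact ⟨a, b, hab, hyy a b hyab, ha, hb⟩

open Classical in
theorem GoodEvent.exchange [Finite V] [DecidableEq V] {B : ℝ} {i j : V} {y : V → α} {v : V} {c : α}
    (hc : ∀ w, y w ≠ c) {ω : (α → V) × (κ → V)}
    (hgood : GoodEvent B i j (Function.update y v c) ω) :
    GoodEvent B i j y (exchange y v c ω) := by
  obtain ⟨h, K⟩ := ω
  have hyy : ∀ a b, Function.update y v c a = Function.update y v c b → y a = y b := by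
    intro a b hab
    by_cases ha : a = v <;> by_cases hb : b = v
    · rw [ha, hb]
    · simp [ha, hb] at hab; exact absurd hab.symm (hc b)
    · simp [ha, hb] at hab; exact absurd hab (hc a)
    · simpa [ha, hb] using hab
  have hne : ∀ w, y w ≠ y v → w ≠ v := fun w hw e => hw (e ▸ rfl)
  have hsub' : stoppedReach y v h K ⊆ reachSet (h ∘ Function.update y v c) K :=
    stoppedReach_subset _ _ _ _ _ fun w hw => by simp [hne w hw]
  by_cases hv : v ∈ stoppedReach y v h K
  · simp only [_root_.exchange, hv, if_true]
    refine hgood.of_redirect (A := {w | y w = y v ∧ w ≠ v}) (p := v) (by simp)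
      (fun w hw => hw.1) ?_ ?_ ?_ (hsub' hv) hyy
    · intro w hw
      by_cases hwv : w = v
      · simp [hwv]
      · have : y w ≠ y v := fun e => hw ⟨e, hwv⟩
        simp [hwv, Equiv.swap_apply_of_ne_of_ne this (hc w)]
    · rintro w ⟨hw, -⟩
      simp [hw]
    · refine stoppedReach_subset y v h K _ (fun w hw => ?_) hv
      simp [Equiv.swap_apply_of_ne_of_ne hw (hc w)]
  · simp only [_root_.exchange, hv, if_false]
    have hsub : stoppedReach y v h K ⊆ reachSet (h ∘ y) K :=
      stoppedReach_subset _ _ _ _ _ fun w _ => rfl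
    by_cases hp : ∃ p ∈ stoppedReach y v h K, y p = y v
    · obtain ⟨p, hp, hyp⟩ := hp
      have hpv : p ≠ v := fun e => hv (e ▸ hp)
      refine hgood.of_redirect (A := {v}) (p := p) hpv ?_ ?_ ?_ (hsub hp) (hsub' hp) hyy
      · rintro w rfl
        exact hyp.symm
      · intro w hw
        have hwv : w ≠ v := hw
        simp [hwv]
      · rintro w rfl
        simp [hpv, hyp]
    · push Not at hp
      have h1 : stoppedReach y v h K = reachSet (h ∘ y) K :=
        reachSet_eq_of_eqOn fun w hw => by simp [hp w hw]
      have h2 : stoppedReach y v h K = reachSet (h ∘ Function.update y v c) K :=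
        reachSet_eq_of_eqOn fun w hw => by simp [hp w hw, hne w (hp w hw)]
      obtain ⟨hcard, hor⟩ := hgood
      unfold GoodEvent
      simp only [← h1, ← h2] at *
      refine ⟨hcard, hor.imp_left ?_⟩
      rintro ⟨a, b, hab, hyab, ha, hb⟩
      exact ⟨a, b, hab, hyy a b hyab, ha, hb⟩

theorem ncard_goodEvent_update_le [Finite V] [Finite κ] [Finite α] [DecidableEq V]
    (B : ℝ) (i j : V) (y : V → α) (v : V) (c : α) (hc : ∀ w, y w ≠ c) :
    {ω : (α → V) × (κ → V) | GoodEvent B i j (Function.update y v c) ω}.ncard ≤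
      {ω : (α → V) × (κ → V) | GoodEvent B i j y ω}.ncard := by
  refine Set.ncard_le_ncard_of_injOn (exchange y v c) (fun ω hω => ?_)
    (exchange_involutive y v c hc).injective.injOn (Set.toFinite _)
  exact GoodEvent.exchange hc hω

/-- Giving all indices distinct labels can only make the good event less likely. -/
theorem ncard_goodEvent_inr_le [Fintype V] [Finite κ] [Finite α]
    (B : ℝ) (i j : V) (x : V → α) :
    {ω : (α ⊕ V → V) × (κ → V) | GoodEvent B i j Sum.inr ω}.ncard ≤
      {ω : (α ⊕ V → V) × (κ → V) | GoodEvent B i j (fun v => Sum.inl (x v)) ω}.ncard := by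
  classical
  have key : ∀ T : Finset V,
      {ω : (α ⊕ V → V) × (κ → V) |
        GoodEvent B i j (fun v => if v ∈ T then Sum.inr v else Sum.inl (x v)) ω}.ncard ≤
      {ω : (α ⊕ V → V) × (κ → V) | GoodEvent B i j (fun v => Sum.inl (x v)) ω}.ncard := by
    intro T
    induction T using Finset.induction_on with
    | empty => simp
    | insert v T hv ih =>
      refine le_trans ?_ ih
      have hupd : (fun w => if w ∈ insert v T then Sum.inr w else Sum.inl (x w)) =
          Function.update (fun w => if w ∈ T then (Sum.inr w : α ⊕ V) else Sum.inl (x w)) v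
            (Sum.inr v) := by
        funext w
        by_cases hw : w = v
        · simp [hw]
        · simp [hw]
      rw [hupd]
      refine ncard_goodEvent_update_le B i j _ v _ fun w => ?_
      split_ifs with hw
      · intro e
        exact hv (Sum.inr_injective e ▸ hw)
      · simp
  simpa using key Finset.univ

end Splitting

section Exploration

variable {V κ : Type*}

/-- The set of vertices found by an exploration in which the vertices in `S` have been seen and
the elements of `Q` still have to be queried. -/
inductive Explored (S : Finset V) (Q : Finset (V ⊕ κ)) (G : V ⊕ κ → V) : V → Prop
  | base (v : V) (hv : v ∈ S) : Explored S Q G v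
  | query (q : V ⊕ κ) (hq : q ∈ Q) : Explored S Q G (G q)
  | step (v : V) (hv : Explored S Q G v) (hvS : v ∉ S) : Explored S Q G (G (Sum.inl v))

variable {S : Finset V} {Q : Finset (V ⊕ κ)} {G G' : V ⊕ κ → V} {q : V ⊕ κ}

theorem Explored.congr (hG : ∀ r, r ≠ q → G r = G' r) (hq : q ∉ Q)
    (hqS : ∀ v, q = Sum.inl v → v ∈ S) {v : V} (h : Explored S Q G v) : Explored S Q G' v := by
  induction h with
  | base v hv => exact .base v hv
  | query r hr =>
    rw [hG r fun e => hq (e ▸ hr)]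
    exact .query r hr
  | step v _ hvS ih =>
    rw [hG _ fun e => hvS (hqS v e.symm)]
    exact .step v ih hvS

theorem explored_empty_iff (v : V) : Explored S (∅ : Finset (V ⊕ κ)) G v ↔ v ∈ S := by
  refine ⟨fun h => ?_, .base v⟩
  induction h with
  | base v hv => exact hv
  | query r hr => simp at hr
  | step v _ hvS ih => exact absurd ih hvS

variable [DecidableEq V] [DecidableEq κ]

theorem explored_erase_iff (hqS : G q ∈ S) (v : V) :
    Explored S Q G v ↔ Explored S (Q.erase q) G v := by
  constructor
  · intro h
    induction h with
    | base v hv => exact .base v hv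
    | query r hr =>
      by_cases hrq : r = q
      · exact .base _ (hrq ▸ hqS)
      · exact .query r (Finset.mem_erase.2 ⟨hrq, hr⟩)
    | step v _ hvS ih => exact .step v ih hvS
  · intro h
    induction h with
    | base v hv => exact .base v hv
    | query r hr => exact .query r (Finset.mem_of_mem_erase hr)
    | step v _ hvS ih => exact .step v ih hvS

theorem explored_insert_iff (hq : q ∈ Q) (hqS : G q ∉ S) (v : V) :
    Explored S Q G v ↔
      Explored (insert (G q) S) (insert (Sum.inl (G q)) (Q.erase q)) G v := by
  constructor
  · intro h
    induction h with
    | base v hv => exact .base v (Finset.mem_insert_of_mem hv)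
    | query r hr =>
      by_cases hrq : r = q
      · exact .base _ (by simp [hrq])
      · exact .query r (by simp [hrq, hr])
    | step v _ hvS ih =>
      by_cases hvq : v = G q
      · exact .query _ (by simp [hvq])
      · exact .step v ih (by simp [hvq, hvS])
  · intro h
    induction h with
    | base v hv =>
      rcases Finset.mem_insert.1 hv with rfl | hv
      · exact .query q hq
      · exact .base v hv
    | query r hr =>
      rcases Finset.mem_insert.1 hr with rfl | hr
      · exact .step _ (.query q hq) hqS
      · exact .query r (Finset.mem_of_mem_erase hr)
    | step v _ hvS ih => exact .step v ih fun h => hvS (Finset.mem_insert_of_mem h)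

end Exploration

section Averaging

open Finset

theorem sum_sum_update {D V : Type*} [Fintype D] [Fintype V] [DecidableEq D] (q : D)
    (F : (D → V) → ℝ) :
    ∑ w : V, ∑ G : D → V, F (Function.update G q w) = Fintype.card V * ∑ G : D → V, F G := by
  have hinv : Function.Involutive
      fun p : V × (D → V) => (p.2 q, Function.update p.2 q p.1) := by
    rintro ⟨w, G⟩
    simp
  have h := Equiv.sum_comp hinv.toPerm fun p : V × (D → V) => F p.2
  rw [Fintype.sum_prod_type, Fintype.sum_prod_type] at h
  simpa using h

theorem explored_start_eq_reachSet {V κ : Type*} [Fintype κ] (G : V ⊕ κ → V) :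
    {v | Explored ∅ (univ.map Function.Embedding.inr) G v} =
      reachSet (G ∘ Sum.inl) (G ∘ Sum.inr) := by
  apply Set.Subset.antisymm
  · intro v hv
    induction hv with
    | base v hv => simp at hv
    | query q hq =>
      obtain ⟨a, -, rfl⟩ := mem_map.1 hq
      exact start_mem_reachSet (G ∘ Sum.inl) (G ∘ Sum.inr) a
    | step v _ _ ih => exact apply_mem_reachSet (f := G ∘ Sum.inl) ih
  · exact reachSet_subset (fun a => .query (Sum.inr a) (by simp)) fun w hw =>
      Explored.step w hw (by simp)

variable {V κ : Type*} [Fintype V] [Fintype κ] [DecidableEq V] [DecidableEq κ]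

/-- Lower bound for the average of `φ` of the number of explored vertices by a function `W` of
the current state which does not decrease on average when one query is answered. -/
theorem card_mul_le_sum_explored [Nonempty V] (φ : ℕ → ℝ) (W : ℕ → ℕ → ℝ)
    (hzero : ∀ d, W d 0 ≤ φ d)
    (hstep : ∀ d q : ℕ, d ≤ Fintype.card V → (Fintype.card V : ℝ) * W d (q + 1) ≤
      d * W d q + (Fintype.card V - d) * W (d + 1) (q + 1))
    (S : Finset V) (Q : Finset (V ⊕ κ)) (hQ : ∀ v, Sum.inl v ∈ Q → v ∈ S) :
    (Fintype.card (V ⊕ κ → V) : ℝ) * W #S #Q ≤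
      ∑ G : V ⊕ κ → V, φ {v | Explored S Q G v}.ncard := by
  induction hN : (Fintype.card V - #S) + #Q using Nat.strong_induction_on generalizing S Q with
  | _ N ih =>
  rcases Q.eq_empty_or_nonempty with rfl | ⟨q, hq⟩
  · have hS : ∀ G : V ⊕ κ → V, {v | Explored S ∅ G v}.ncard = #S := fun G => by
      simp only [explored_empty_iff]
      exact Set.ncard_coe_finset S
    simp only [hS, sum_const, card_univ, nsmul_eq_mul, card_empty]
    exact mul_le_mul_of_nonneg_left (hzero _) (Nat.cast_nonneg _)
  · have hQcard : #(Q.erase q) + 1 = #Q := card_erase_add_one hq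
    have hVpos : (0 : ℝ) < Fintype.card V := by exact_mod_cast Fintype.card_pos
    have hseen : ∀ w ∈ S, (Fintype.card (V ⊕ κ → V) : ℝ) * W #S #(Q.erase q) ≤
        ∑ G : V ⊕ κ → V, φ {v | Explored S Q (Function.update G q w) v}.ncard := by
      intro w hw
      refine (ih _ (by omega) S (Q.erase q)
        (fun v hv => hQ v (mem_of_mem_erase hv)) rfl).trans_eq (sum_congr rfl fun G _ => ?_)
      congr 3
      ext v
      have hqS : ∀ v, q = Sum.inl v → v ∈ S := fun v e => hQ v (e ▸ hq)
      rw [explored_erase_iff (G := Function.update G q w) (q := q) (by simpa using hw)]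
      exact ⟨Explored.congr (fun r hr => by simp [hr]) (notMem_erase q Q) hqS,
        Explored.congr (fun r hr => by simp [hr]) (notMem_erase q Q) hqS⟩
    have hnew : ∀ w ∉ S, (Fintype.card (V ⊕ κ → V) : ℝ) * W (#S + 1) #Q ≤
        ∑ G : V ⊕ κ → V, φ {v | Explored S Q (Function.update G q w) v}.ncard := by
      intro w hw
      have hwQ : Sum.inl w ∉ Q := fun h => hw (hQ w h)
      have hwq : q ≠ Sum.inl w := fun e => hwQ (e ▸ hq)
      have hcS : #(insert w S) = #S + 1 := card_insert_of_notMem hw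
      have hcQ : #(insert (Sum.inl w) (Q.erase q)) = #Q := by
        rw [card_insert_of_notMem (fun h => hwQ (mem_of_mem_erase h)), hQcard]
      have hlt : #S < Fintype.card V := by
        have := card_le_univ (insert w S)
        omega
      have hinv : ∀ v, Sum.inl v ∈ insert (Sum.inl w) (Q.erase q) → v ∈ insert w S := by
        intro v hv
        rcases mem_insert.1 hv with e | hv
        · rw [Sum.inl_injective e]; exact mem_insert_self w S
        · exact mem_insert_of_mem (hQ v (mem_of_mem_erase hv))
      have h := ih _ (by omega) (insert w S) (insert (Sum.inl w) (Q.erase q)) hinv rfl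
      rw [hcS, hcQ] at h
      refine h.trans_eq (sum_congr rfl fun G _ => ?_)
      congr 3
      ext v
      have hqS : ∀ v, q = Sum.inl v → v ∈ insert w S :=
        fun v e => mem_insert_of_mem (hQ v (e ▸ hq))
      have hq' : q ∉ insert (Sum.inl w) (Q.erase q) := by simp [hwq]
      rw [explored_insert_iff (G := Function.update G q w) hq (by simpa using hw)]
      simp only [Function.update_self]
      exact ⟨Explored.congr (fun r hr => by simp [hr]) hq' hqS,
        Explored.congr (fun r hr => by simp [hr]) hq' hqS⟩
    refine le_of_mul_le_mul_left ?_ hVpos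
    rw [← sum_sum_update q, ← sum_add_sum_compl S]
    have h1 := card_nsmul_le_sum S _ _ hseen
    have h2 := card_nsmul_le_sum Sᶜ _ _ fun w hw => hnew w (mem_compl.1 hw)
    have h3 := hstep #S #(Q.erase q) (card_le_univ S)
    rw [hQcard] at h3
    rw [nsmul_eq_mul] at h1 h2
    rw [card_compl, Nat.cast_sub (card_le_univ S)] at h2
    have h4 := mul_le_mul_of_nonneg_left h3 (Nat.cast_nonneg (α := ℝ) (Fintype.card (V ⊕ κ → V)))
    linarith

theorem card_mul_le_sum_reachSet [Nonempty V] (φ : ℕ → ℝ) (W : ℕ → ℕ → ℝ)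
    (hzero : ∀ d, W d 0 ≤ φ d)
    (hstep : ∀ d q : ℕ, d ≤ Fintype.card V → (Fintype.card V : ℝ) * W d (q + 1) ≤
      d * W d q + (Fintype.card V - d) * W (d + 1) (q + 1)) :
    (Fintype.card ((V → V) × (κ → V)) : ℝ) * W 0 (Fintype.card κ) ≤
      ∑ ω : (V → V) × (κ → V), φ (reachSet ω.1 ω.2).ncard := by
  have h := card_mul_le_sum_explored (κ := κ) φ W hzero hstep ∅
    (univ.map Function.Embedding.inr) (by simp)
  simp only [explored_start_eq_reachSet, card_map, card_univ, card_empty] at h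
  rw [Fintype.card_congr (Equiv.sumArrowEquivProdArrow V κ V)] at h
  refine h.trans_eq ?_
  exact Equiv.sum_comp (Equiv.sumArrowEquivProdArrow V κ V)
    fun ω => φ (reachSet ω.1 ω.2).ncard

/-- By symmetry, all ordered pairs of distinct vertices are equally likely to be reached. -/
theorem sum_reachSet_eq_card_mul (B : ℝ) {i j : V} (hij : i ≠ j) :
    ∑ ω : (V → V) × (κ → V), (if ((reachSet ω.1 ω.2).ncard : ℝ) ≤ B then
        ((reachSet ω.1 ω.2).ncard : ℝ) * ((reachSet ω.1 ω.2).ncard - 1) else 0) =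
      (Fintype.card V : ℝ) * (Fintype.card V - 1) *
        {ω : (V → V) × (κ → V) | ((reachSet ω.1 ω.2).ncard : ℝ) ≤ B ∧
          i ∈ reachSet ω.1 ω.2 ∧ j ∈ reachSet ω.1 ω.2}.ncard := by
  classical
  set E : V → V → Set ((V → V) × (κ → V)) := fun a b =>
    {ω | ((reachSet ω.1 ω.2).ncard : ℝ) ≤ B ∧ a ∈ reachSet ω.1 ω.2 ∧ b ∈ reachSet ω.1 ω.2}
    with hE
  have hle : ∀ a b c d : V, a ≠ b → c ≠ d → (E a b).ncard ≤ (E c d).ncard := by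
    intro a b c d hab hcd
    obtain ⟨π, hπa, hπb⟩ : ∃ π : Equiv.Perm V, π a = c ∧ π b = d := by
      refine ⟨Equiv.swap (Equiv.swap a c b) d * Equiv.swap a c, ?_, by simp⟩
      have h1 : c ≠ Equiv.swap a c b := by
        intro h
        apply hab
        apply (Equiv.swap a c).injective
        rw [← h, Equiv.swap_apply_left]
      simp [Equiv.swap_apply_of_ne_of_ne h1 hcd]
    refine Set.ncard_le_ncard_of_injOn (fun ω => (π ∘ ω.1 ∘ π.symm, π ∘ ω.2)) ?_ ?_
      (Set.toFinite _)
    · rintro ω ⟨hB, ha, hb⟩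
      refine ⟨?_, ?_, ?_⟩ <;> simp only [image_reachSet]
      · rwa [Set.ncard_image_of_injective _ π.injective]
      · exact ⟨a, ha, hπa⟩
      · exact ⟨b, hb, hπb⟩
    · rintro ⟨f, K⟩ - ⟨f', K'⟩ - h
      simp only [Prod.mk.injEq] at h
      have hf : f = f' := by
        funext v
        have := congrFun h.1 (π v)
        simpa using this
      have hK : K = K' := π.injective.comp_left h.2
      rw [hf, hK]
  have hcardE : ∀ a b : V, ((E a b).ncard : ℝ) = ∑ ω : (V → V) × (κ → V),
      if ω ∈ E a b then 1 else 0 := by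
    intro a b
    rw [Set.ncard_eq_toFinset_card', ← Finset.sum_filter]
    simp [Set.toFinset]
  have hsum : ∑ p ∈ (univ : Finset V).offDiag, ((E p.1 p.2).ncard : ℝ) =
      (Fintype.card V : ℝ) * (Fintype.card V - 1) * (E i j).ncard := by
    rw [sum_congr rfl fun p hp => congrArg Nat.cast (le_antisymm
      (hle p.1 p.2 i j (mem_offDiag.1 hp).2.2 hij) (hle i j p.1 p.2 hij (mem_offDiag.1 hp).2.2)),
      sum_const, offDiag_card, nsmul_eq_mul, card_univ, Nat.cast_sub (Nat.le_mul_self _)]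
    push_cast
    ring
  rw [← hsum]
  simp only [hcardE]
  rw [sum_comm]
  refine sum_congr rfl fun ω _ => ?_
  by_cases hB : ((reachSet ω.1 ω.2).ncard : ℝ) ≤ B
  · have hset : ((univ : Finset V).offDiag.filter fun p => ω ∈ E p.1 p.2) =
        (reachSet ω.1 ω.2).toFinset.offDiag := by
      ext p
      simp [hE, hB]
      tauto
    rw [← Finset.sum_filter, hset, sum_const, offDiag_card, nsmul_eq_mul,
      Nat.cast_sub (Nat.le_mul_self _), if_pos hB, ← Set.ncard_eq_toFinset_card']
    push_cast
    ring
  · simp [hE, hB]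

end Averaging

/-- The potential function bounding the expected number of ordered pairs of distinct reached
vertices when `d` vertices have been seen and `q` queries are pending. -/
noncomputable def pairPotential (n k : ℝ) (d q : ℕ) : ℝ :=
  d * (d - 1) + 9 / 5 * n * q - 5 / (18 * (k * n)) *
    ((d + 1) * d * (d - 1) * (d - 2) + 4 * n * q * (d * (d - 1)) + 4 * n ^ 2 * (q * (q + 1)))

theorem pairPotential_zero_le {n k : ℝ} (hkn : 128 ≤ k * n) (d : ℕ) :
    pairPotential n k d 0 ≤ if (d : ℝ) ≤ 2 * √(k * n) then (d : ℝ) * (d - 1) else 0 := by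
  have hpos : 0 < k * n := by linarith
  have hW : pairPotential n k d 0 =
      d * (d - 1) - 5 / (18 * (k * n)) * ((d + 1) * d * (d - 1) * (d - 2)) := by
    simp [pairPotential]
  rw [hW]
  split_ifs with h
  · have h0 : (0 : ℝ) ≤ (d + 1) * d * (d - 1) * (d - 2) := by
      rcases d with _ | _ | d
      · simp
      · simp
      · push_cast
        have : (0 : ℝ) ≤ d := Nat.cast_nonneg d
        have e : ((d : ℝ) + 1 + 1 + 1) * (d + 1 + 1) * (d + 1 + 1 - 1) * (d + 1 + 1 - 2) =
          (d + 3) * (d + 2) * (d + 1) * d := by ring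
        rw [e]
        positivity
    have : 0 ≤ 5 / (18 * (k * n)) * (((d : ℝ) + 1) * d * (d - 1) * (d - 2)) := by positivity
    linarith
  · push Not at h
    have hd2 : 4 * (k * n) < (d : ℝ) ^ 2 := by
      have h1 := Real.sq_sqrt hpos.le
      have h2 := Real.sqrt_nonneg (k * n)
      nlinarith
    have hd : (20 : ℝ) ≤ d := by nlinarith [(Nat.cast_nonneg d : (0 : ℝ) ≤ d)]
    have h3 : 18 * (k * n) ≤ 5 * ((d + 1) * (d - 2)) := by nlinarith
    have h4 : (1 : ℝ) ≤ 5 / (18 * (k * n)) * ((d + 1) * (d - 2)) := by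
      rw [div_mul_eq_mul_div, le_div_iff₀ (by positivity)]
      linarith
    have h5 : (0 : ℝ) ≤ d * (d - 1) := by nlinarith
    nlinarith

theorem pairPotential_step {n k : ℝ} (hk : 2 ≤ k) (hkn : 32 * k ≤ n) (d q : ℕ) :
    n * pairPotential n k d (q + 1) ≤
      d * pairPotential n k d q + (n - d) * pairPotential n k (d + 1) (q + 1) := by
  have hn : 0 < n := by linarith
  have hk0 : 0 < k := by linarith
  have hd0 : (0 : ℝ) ≤ d := Nat.cast_nonneg d
  have hq0 : (0 : ℝ) ≤ q := Nat.cast_nonneg q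
  have hdiff : d * pairPotential n k d q + (n - d) * pairPotential n k (d + 1) (q + 1) -
      n * pairPotential n k d (q + 1) = d * (1 / 5 * n - 2 * d + 10 / (9 * k * n) *
        (n * (d + 1) + d * (d ^ 2 - 1) + 2 * q * (n * d))) := by
    unfold pairPotential
    push_cast
    field_simp
    ring
  have hmain : 0 ≤ 1 / 5 * n - 2 * d + 10 / (9 * k * n) *
        (n * (d + 1) + d * (d ^ 2 - 1) + 2 * q * (n * d)) := by
    have h1 : 0 ≤ 1 / 5 * n - 2 * d + 32 * d ^ 3 / n ^ 2 := by
      have : 1 / 5 * n - 2 * d + 32 * d ^ 3 / n ^ 2 =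
          (1 / 5 * n ^ 3 - 2 * d * n ^ 2 + 32 * d ^ 3) / n ^ 2 := by field_simp
      rw [this]
      apply div_nonneg _ (by positivity)
      nlinarith [mul_nonneg hd0 (sq_nonneg (7 * d - n)), mul_nonneg hn.le (sq_nonneg (7 * d - n))]
    have h2 : 32 * d ^ 3 / n ^ 2 ≤ 10 / (9 * k * n) * d ^ 3 := by
      rw [div_mul_eq_mul_div, div_le_div_iff₀ (by positivity) (by positivity)]
      have : 0 ≤ (d : ℝ) ^ 3 * n * (n - 32 * k) := by
        have : 0 ≤ n - 32 * k := by linarith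
        positivity
      nlinarith [mul_nonneg (pow_nonneg hd0 3) (sq_nonneg n)]
    have h3 : 0 ≤ 10 / (9 * k * n) * (n * (d + 1) - d + 2 * q * (n * d)) := by
      have : 0 ≤ n * ((d : ℝ) + 1) - d := by nlinarith
      positivity
    have h4 : 10 / (9 * k * n) * (n * (d + 1) + d * (d ^ 2 - 1) + 2 * q * (n * d)) =
      10 / (9 * k * n) * d ^ 3 + 10 / (9 * k * n) * (n * (d + 1) - d + 2 * q * (n * d)) := by ring
    linarith
  nlinarith [mul_nonneg hd0 hmain]

theorem le_pairPotential_start {n : ℝ} {k : ℕ} (hk : 2 ≤ k) (hn : 0 < n) :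
    k * n / 18 ≤ pairPotential n k 0 k := by
  have hk' : (2 : ℝ) ≤ k := by exact_mod_cast hk
  have h : pairPotential n k 0 k = 9 / 5 * n * k - 10 / 9 * n * (k + 1) := by
    unfold pairPotential
    have : (k : ℝ) ≠ 0 := by positivity
    field_simp
    push_cast
    ring
  rw [h]
  nlinarith

/-- Values on labels that do not matter contribute a constant factor to the count. -/
theorem ncard_setOf_comp_equiv_inl {α β γ V C : Type*} [Fintype β] [Fintype V] [DecidableEq β]
    (e : α ⊕ β ≃ γ) (P : (α → V) × C → Prop) :
    {ω : (γ → V) × C | P (ω.1 ∘ e ∘ Sum.inl, ω.2)}.ncard =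
      {ω | P ω}.ncard * Fintype.card (β → V) := by
  have himage : {ω : (γ → V) × C | P (ω.1 ∘ e ∘ Sum.inl, ω.2)} =
      (fun p : ((α → V) × C) × (β → V) => (Sum.elim p.1.1 p.2 ∘ e.symm, p.1.2)) ''
        ({ω | P ω} ×ˢ Set.univ) := by
    ext ω
    constructor
    · intro hω
      refine ⟨((ω.1 ∘ e ∘ Sum.inl, ω.2), ω.1 ∘ e ∘ Sum.inr), ⟨hω, trivial⟩, ?_⟩
      refine Prod.ext (funext fun c => ?_) rfl
      obtain ⟨a | b, rfl⟩ := e.surjective c <;> simp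
    · rintro ⟨p, ⟨hp, -⟩, rfl⟩
      have : (Sum.elim p.1.1 p.2 ∘ e.symm) ∘ e ∘ Sum.inl = p.1.1 := by
        funext a
        simp
      simpa [this] using hp
  rw [himage, Set.ncard_image_of_injective, Set.ncard_prod, Set.ncard_univ,
    Nat.card_eq_fintype_card]
  rintro ⟨⟨h, K⟩, g⟩ ⟨⟨h', K'⟩, g'⟩ heq
  simp only [Prod.mk.injEq] at heq
  have hs := e.symm.surjective.injective_comp_right heq.1
  have h1 : h = h' := funext fun a => congrFun hs (Sum.inl a)
  have h2 : g = g' := funext fun b => congrFun hs (Sum.inr b)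
  rw [h1, h2, heq.2]


/-- Let `x ∈ [m]^n` contain a duplicate (`ED(x) = 0`), let `h : [m] → [n]` be uniformly
random and `K` be `k` independent uniform starting indices with `2 ≤ k ≤ n/32`.
With `f_{x,h}(i) = h(x_i)`, the probability that `|f*_{x,h}(K)| ≤ 2√(kn)` and
`f*_{x,h}(K)` contains two indices `i ≠ j` with `x_i = x_j` is at least `k/(18n)`. -/
theorem stmt17 (n m k : ℕ) (hm : 1 ≤ m) (hk : 2 ≤ k) (hkn : 32 * k ≤ n)
    (x : Fin n → Fin m) (hdup : ¬ Function.Injective x) :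
    (k : ℝ) / (18 * n) ≤
      (Set.ncard {ω : (Fin m → Fin n) × (Fin k → Fin n) |
          (Set.ncard {j : Fin n | ∃ a : Fin k, ∃ i : ℕ,
            (fun r => ω.1 (x r))^[i] (ω.2 a) = j} : ℝ) ≤ 2 * Real.sqrt ((k : ℝ) * n) ∧
          ∃ i j : Fin n, i ≠ j ∧ x i = x j ∧
            (∃ a : Fin k, ∃ s : ℕ, (fun r => ω.1 (x r))^[s] (ω.2 a) = i) ∧
            (∃ a : Fin k, ∃ s : ℕ, (fun r => ω.1 (x r))^[s] (ω.2 a) = j)} : ℝ) /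
        (Fintype.card ((Fin m → Fin n) × (Fin k → Fin n)) : ℝ) := by
  obtain ⟨i, j, hxij, hij⟩ : ∃ i j, x i = x j ∧ i ≠ j := by
    simpa [Function.Injective] using hdup
  have hk' : (2 : ℝ) ≤ k := by exact_mod_cast hk
  have hkn' : (32 : ℝ) * k ≤ n := by exact_mod_cast hkn
  have hn : (64 : ℝ) ≤ n := by linarith
  have : NeZero n := ⟨by omega⟩
  set B := 2 * √((k : ℝ) * n)
  set T := {ω : (Fin m → Fin n) × (Fin k → Fin n) |
    ((reachSet (ω.1 ∘ x) ω.2).ncard : ℝ) ≤ B ∧ ∃ p q : Fin n, p ≠ q ∧ x p = x q ∧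
      p ∈ reachSet (ω.1 ∘ x) ω.2 ∧ q ∈ reachSet (ω.1 ∘ x) ω.2}
  set D := {ω : (Fin n → Fin n) × (Fin k → Fin n) | ((reachSet ω.1 ω.2).ncard : ℝ) ≤ B ∧
    i ∈ reachSet ω.1 ω.2 ∧ j ∈ reachSet ω.1 ω.2}
  change (k : ℝ) / (18 * n) ≤ (T.ncard : ℝ) / _
  have hcompare : D.ncard * n ^ m ≤ T.ncard * n ^ n := by
    have hD := ncard_setOf_comp_equiv_inl (Equiv.sumComm (Fin n) (Fin m)) (· ∈ D)
    have hT := ncard_setOf_comp_equiv_inl (Equiv.refl (Fin m ⊕ Fin n)) (· ∈ T)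
    simp only [Fintype.card_fun, Fintype.card_fin] at hD hT
    refine hD.symm.trans_le (le_trans ?_ hT.le)
    refine le_trans (Set.ncard_le_ncard ?_ (Set.toFinite _))
      ((ncard_goodEvent_inr_le B i j x).trans (Set.ncard_le_ncard ?_ (Set.toFinite _)))
    · rintro ω ⟨hcard, hi, hj⟩
      exact ⟨hcard, Or.inr ⟨hi, hj⟩⟩
    · rintro ω ⟨hcard, ⟨p, q, hpq, hxpq, hp, hq⟩ | ⟨hi, hj⟩⟩
      · exact ⟨hcard, p, q, hpq, Sum.inl_injective hxpq, hp, hq⟩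
      · exact ⟨hcard, i, j, hij, hxij, hi, hj⟩
  have hpairs : (n : ℝ) ^ n * n ^ k * (k * n / 18) ≤ n * (n - 1) * D.ncard := by
    have h := card_mul_le_sum_reachSet (V := Fin n) (κ := Fin k) _ (pairPotential n k)
      (pairPotential_zero_le (by nlinarith)) (fun d q _ => by
        simpa using pairPotential_step hk' hkn' d q)
    have hsymm := sum_reachSet_eq_card_mul (κ := Fin k) B hij
    simp only [Fintype.card_prod, Fintype.card_fun, Fintype.card_fin] at h hsymm
    rw [hsymm] at h
    push_cast at h
    refine le_trans ?_ h
    exact mul_le_mul_of_nonneg_left (le_pairPotential_start hk (by linarith)) (by positivity)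
  have hcompare' : (D.ncard : ℝ) * n ^ m ≤ T.ncard * n ^ n := by exact_mod_cast hcompare
  have hn0 : (0 : ℝ) < n := by linarith
  simp only [Fintype.card_prod, Fintype.card_fun, Fintype.card_fin]
  push_cast
  rw [div_le_div_iff₀ (by positivity) (by positivity)]
  have hD : (n : ℝ) ^ n * n ^ k * k ≤ 18 * n * D.ncard := by
    have h1 : (n : ℝ) * (n - 1) * D.ncard ≤ n * n * D.ncard := by gcongr; linarith
    refine le_of_mul_le_mul_left ?_ hn0
    linarith
  have hnn : (0 : ℝ) < n ^ n := by positivity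
  refine le_of_mul_le_mul_left ?_ hnn
  calc (n : ℝ) ^ n * (k * (n ^ m * n ^ k)) = n ^ n * n ^ k * k * n ^ m := by ring
    _ ≤ 18 * n * D.ncard * n ^ m := by gcongr
    _ = 18 * n * (D.ncard * n ^ m) := by ring
    _ ≤ 18 * n * (T.ncard * n ^ n) := by gcongr
    _ = n ^ n * (T.ncard * (18 * n)) := by ring
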